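/- arXiv:2209.10264 — 2 statements merged into one kernel-verified Lean document; each statement's English description precedes it below -/
import Mathlib

section
/- Let O(w) be an octagonal chain with n octagons (n ≥ 3) and w = (w_1,...,w_{n−2}), and suppose that for some index i ∈ {1,...,n−2} one has w_i = 0 or w_i = 4. Let w' = (w_1,...,w_{i−1}, 3, 4−w_{i+1},...,4−w_{n−2}). Then Kf(O(w)) < Kf(O(w')). -/
/-!  Common definitions: Moore–Penrose pseudoinverse, resistance distance and
Kirchhoff index of a simple graph (unit resistors), weighted electrical networks
(given by a symmetric conductance function), multigraph electrical networks,
and the octagonal chains `O(w)`.  -/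

/-- `M` is a Moore–Penrose pseudoinverse of `A`. -/
def Matrix.IsMoorePenroseInv {n : Type} [Fintype n] (A M : Matrix n n ℝ) : Prop :=
  A * M * A = A ∧ M * A * M = M ∧ (A * M).transpose = A * M ∧ (M * A).transpose = M * A

open Classical in
/-- The Moore–Penrose pseudoinverse of a real square matrix (it exists and is
unique; defined by choice). -/
noncomputable def mpinv {n : Type} [Fintype n] (A : Matrix n n ℝ) : Matrix n n ℝ :=
  if h : ∃ M, A.IsMoorePenroseInv M then h.choose else 0

open Classical in
/-- The (real) Laplacian matrix of a simple graph: degree diagonal minus adjacency. -/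
noncomputable def glap {V : Type} [Fintype V] (G : SimpleGraph V) : Matrix V V ℝ :=
  fun u v =>
    if u = v then ((Finset.univ.filter (fun t => G.Adj u t)).card : ℝ)
    else if G.Adj u v then -1 else 0

/-- Resistance distance `r_G(u,v) = (e_u - e_v)ᵀ L⁺ (e_u - e_v)` in a simple graph,
each edge being a unit resistor. -/
noncomputable def resDist {V : Type} [Fintype V] (G : SimpleGraph V) (u v : V) : ℝ :=
  mpinv (glap G) u u - mpinv (glap G) u v - mpinv (glap G) v u + mpinv (glap G) v v

/-- `r_G(a)`: the sum of the resistance distances between `a` and all other vertices. -/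
noncomputable def resSum {V : Type} [Fintype V] [DecidableEq V] (G : SimpleGraph V) (a : V) : ℝ :=
  ∑ b ∈ Finset.univ.erase a, resDist G a b

/-- The Kirchhoff index: the sum of resistance distances over all unordered pairs. -/
noncomputable def kirchhoff {V : Type} [Fintype V] (G : SimpleGraph V) : ℝ :=
  (∑ u, ∑ v, resDist G u v) / 2

/-- A weighted graph (electrical network) on `V`, recorded by its symmetric
conductance function: `cond u v` is the reciprocal of the resistance of the edge
`uv` (and `0` if there is no such edge). -/
structure Network (V : Type) where
  cond : V → V → ℝ
  symm : ∀ u v, cond u v = cond v u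
  nonneg : ∀ u v, 0 ≤ cond u v
  loopless : ∀ v, cond v v = 0

/-- The weighted Laplacian of a network. -/
noncomputable def Network.lap {V : Type} [Fintype V] [DecidableEq V] (N : Network V) :
    Matrix V V ℝ :=
  fun u v => if u = v then ∑ t, N.cond u t else -N.cond u v

/-- Effective resistance in a network, via the pseudoinverse of the weighted Laplacian. -/
noncomputable def Network.effRes {V : Type} [Fintype V] [DecidableEq V] (N : Network V)
    (u v : V) : ℝ :=
  mpinv N.lap u u - mpinv N.lap u v - mpinv N.lap v u + mpinv N.lap v v

/-- The underlying simple graph of a network. -/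
def Network.toGraph {V : Type} (N : Network V) : SimpleGraph V :=
  SimpleGraph.fromRel (fun u v => N.cond u v ≠ 0)

/-- An electrical network with multiple edges allowed: a finite edge type, each edge a
non-loop with two endpoints and a positive resistance. -/
structure MultiNetwork (V : Type) where
  E : Type
  [fE : Fintype E]
  ends : E → Sym2 V
  not_loop : ∀ e, ¬ (ends e).IsDiag
  res : E → ℝ
  res_pos : ∀ e, 0 < res e

attribute [instance] MultiNetwork.fE

/-- Total conductance between `u` and `v`: the sum, over all edges joining `u` and `v`,
of the reciprocals of their resistances. -/
noncomputable def MultiNetwork.cond {V : Type} [DecidableEq V] (M : MultiNetwork V)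
    (u v : V) : ℝ :=
  ∑ e ∈ Finset.univ.filter (fun e => M.ends e = s(u, v)), (M.res e)⁻¹

/-- The weighted Laplacian of a multigraph network. -/
noncomputable def MultiNetwork.lap {V : Type} [Fintype V] [DecidableEq V]
    (M : MultiNetwork V) : Matrix V V ℝ :=
  fun u v => if u = v then ∑ t, M.cond u t else -M.cond u v

/-- Effective resistance in a multigraph network. -/
noncomputable def MultiNetwork.effRes {V : Type} [Fintype V] [DecidableEq V]
    (M : MultiNetwork V) (u v : V) : ℝ :=
  mpinv M.lap u u - mpinv M.lap u v - mpinv M.lap v u + mpinv M.lap v v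

/-- The underlying simple graph of a multigraph network. -/
def MultiNetwork.toGraph {V : Type} (M : MultiNetwork V) : SimpleGraph V :=
  SimpleGraph.fromRel (fun u v => ∃ e, M.ends e = s(u, v))

/-!  The octagonal chain `O(w)` with `n` octagons, `w = (w_1, …, w_{n-2})`,
`w_i ∈ {0,1,2,3,4}`.  Its `6n+2` vertices are laid out along the outer boundary
cycle `0, 1, …, 6n+1`: position `0` is the top-left corner, the top boundary runs
rightwards (the top of the octagon `H_i`, `1 ≤ i ≤ n-2`, carries `w_i` inserted
vertices), then the right vertical edge, then the bottom boundary runs leftwards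
back to the bottom-left corner `6n+1`.  The graph is this outer cycle together
with the `n-1` chords `t_k b_k` shared by consecutive octagons. -/

/-- Boundary position of the top vertex `t_k` (`1 ≤ k ≤ n-1`) of the `k`-th shared
vertical edge: `t_k = k + w_1 + ⋯ + w_{k-1}`. -/
def tpos (n : ℕ) (w : Fin (n - 2) → Fin 5) (k : ℕ) : ℕ :=
  k + ∑ j ∈ Finset.univ.filter (fun j : Fin (n - 2) => (j : ℕ) + 1 < k), ((w j : ℕ))

/-- Boundary position of the bottom vertex `b_k` (`1 ≤ k ≤ n-1`) of the `k`-th shared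
vertical edge: `b_k = n + (w_1 + ⋯ + w_{n-2}) + 6 + Σ_{j ≥ k} (5 - w_j)`. -/
def bpos (n : ℕ) (w : Fin (n - 2) → Fin 5) (k : ℕ) : ℕ :=
  n + (∑ j, ((w j : ℕ))) + 6 +
    ∑ j ∈ Finset.univ.filter (fun j : Fin (n - 2) => k ≤ (j : ℕ) + 1), (5 - ((w j : ℕ)))

/-- The octagonal chain `O(w)` with `n` octagons: the outer boundary cycle on
`6n+2` vertices together with the chords `t_k b_k`, `k = 1, …, n-1`. -/
def octChain (n : ℕ) (w : Fin (n - 2) → Fin 5) : SimpleGraph (Fin (6 * n + 2)) :=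
  SimpleGraph.fromRel (fun a b =>
    ((a : ℕ) + 1 = (b : ℕ)) ∨ ((a : ℕ) = 6 * n + 1 ∧ (b : ℕ) = 0) ∨
    ∃ k, 1 ≤ k ∧ k ≤ n - 1 ∧ (a : ℕ) = tpos n w k ∧ (b : ℕ) = bpos n w k)

section KirchAux

open Classical in
lemma glap_symm {V : Type} [Fintype V] (G : SimpleGraph V) (u v : V) :
    glap G u v = glap G v u := by
  unfold glap
  by_cases h : u = v
  · subst h; rfl
  · simp only [if_neg h, if_neg (Ne.symm h)]
    exact if_congr (G.adj_comm u v) rfl rfl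

open Classical in
lemma glap_form {V : Type} [Fintype V] (G : SimpleGraph V) (x g : V → ℝ) :
    ∑ u, ∑ v, glap G u v * x v * g u
      = (∑ u, ∑ v, if G.Adj u v then (x u - x v) * (g u - g v) else 0) / 2 := by
  have h1 : ∀ u, ∑ v, glap G u v * x v * g u
      = ∑ v, if G.Adj u v then (x u - x v) * g u else 0 := by
    intro u
    have e : ∀ v, glap G u v * x v * g u =
        (if u = v then (∑ t, if G.Adj u t then x u * g u else 0) else 0)
          - (if G.Adj u v then x v * g u else 0) := by
      intro v
      unfold glap
      by_cases h : u = v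
      · subst h
        simp [← Finset.sum_filter]
        ring
      · by_cases h2 : G.Adj u v <;> simp [h, h2]
    rw [Finset.sum_congr rfl (fun v _ => e v), Finset.sum_sub_distrib,
      Finset.sum_ite_eq, if_pos (Finset.mem_univ u), ← Finset.sum_sub_distrib]
    refine Finset.sum_congr rfl fun v _ => ?_
    split_ifs <;> ring
  have h2 : ∑ u, ∑ v, glap G u v * x v * g u
      = ∑ u, ∑ v, if G.Adj u v then (x u - x v) * g u else 0 :=
    Finset.sum_congr rfl fun u _ => h1 u
  have h3 : (∑ u, ∑ v, if G.Adj u v then (x u - x v) * g u else 0)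
      = ∑ u, ∑ v, if G.Adj u v then (x v - x u) * g v else 0 := by
    rw [Finset.sum_comm]
    refine Finset.sum_congr rfl fun u _ => Finset.sum_congr rfl fun v _ => ?_
    simp [G.adj_comm]
  have h4 : (∑ u, ∑ v, if G.Adj u v then (x u - x v) * (g u - g v) else 0)
      = (∑ u, ∑ v, if G.Adj u v then (x u - x v) * g u else 0)
        + ∑ u, ∑ v, if G.Adj u v then (x v - x u) * g v else 0 := by
    rw [← Finset.sum_add_distrib]
    refine Finset.sum_congr rfl fun u _ => ?_
    rw [← Finset.sum_add_distrib]
    refine Finset.sum_congr rfl fun v _ => ?_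
    split_ifs <;> ring
  rw [h4, ← h3, h2]; ring

open Matrix in
lemma kirchhoff_eq {V : Type} [Fintype V] [DecidableEq V] (G : SimpleGraph V)
    (K : V → V → ℝ) (hs : ∀ u v, K u v = K v u) (b : V)
    (hrep : ∀ z (g : V → ℝ), ∑ u, ∑ v, glap G u v * K z v * g u = g z - g b) :
    kirchhoff G = (Fintype.card V : ℝ) * ∑ v, K v v - ∑ u, ∑ v, K u v := by
  classical
  set L : Matrix V V ℝ := glap G with hL
  set KM : Matrix V V ℝ := Matrix.of K with hKM
  set J : Matrix V V ℝ := Matrix.of (fun _ _ => 1) with hJ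
  set Q : Matrix V V ℝ := Matrix.of (fun u _ => if u = b then 1 else 0) with hQ
  have hN : (Fintype.card V : ℝ) ≠ 0 := by
    have : Nonempty V := ⟨b⟩
    exact_mod_cast Fintype.card_ne_zero
  set c : ℝ := (Fintype.card V : ℝ)⁻¹ with hc
  have LT : Lᵀ = L := by ext u v; exact glap_symm G v u
  have KT : KMᵀ = KM := by ext u v; exact hs v u
  have JT : Jᵀ = J := by ext u v; rfl
  have LK : L * KM = 1 - Q := by
    ext u z
    have := hrep z (fun t => if t = u then 1 else 0)
    simp only [mul_ite, mul_one, mul_zero] at this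
    rw [Finset.sum_comm] at this
    simp only [Finset.sum_ite_eq', Finset.mem_univ, if_true] at this
    rw [Matrix.mul_apply]
    simp only [hKM, hQ, Matrix.of_apply, Matrix.sub_apply, Matrix.one_apply]
    rw [show (∑ x, L u x * K x z) = ∑ x, glap G u x * K z x from
      Finset.sum_congr rfl fun x _ => by rw [hs x z], this]
    simp [eq_comm]
  have LJ : L * J = 0 := by
    ext u z
    rw [Matrix.mul_apply]
    have := glap_form G (fun _ => 1) (fun t => if t = u then 1 else 0)
    simp only [mul_ite, mul_one, mul_zero] at this
    rw [Finset.sum_comm] at this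
    simp only [Finset.sum_ite_eq', Finset.mem_univ, if_true] at this
    simpa [hJ] using this
  have JL : J * L = 0 := by
    have := congrArg Matrix.transpose LJ
    rwa [Matrix.transpose_mul, LT, JT, Matrix.transpose_zero] at this
  have QJ : Q * J = (Fintype.card V : ℝ) • Q := by
    ext u z; simp [Matrix.mul_apply, hQ, hJ]
  have JJ : J * J = (Fintype.card V : ℝ) • J := by
    ext u z; simp [Matrix.mul_apply, hJ]
  set P : Matrix V V ℝ := 1 - c • J with hP
  have PT : Pᵀ = P := by simp [hP, JT]
  have LP : L * P = L := by simp [hP, mul_sub, LJ]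
  have PL : P * L = L := by simp [hP, sub_mul, JL]
  have QP : Q * P = 0 := by
    simp [hP, mul_sub, QJ, smul_smul, hc, inv_mul_cancel₀ hN]
  have PP : P * P = P := by
    have : J * P = 0 := by simp [hP, mul_sub, JJ, smul_smul, hc, inv_mul_cancel₀ hN]
    conv_lhs => rw [hP, sub_mul, ← hP]
    simp [this]
  have hM : L * (P * KM * P) = P := by
    rw [← mul_assoc, ← mul_assoc, LP, LK, sub_mul, QP]; simp
  have hM2 : (P * KM * P) * L = P := by
    have := congrArg Matrix.transpose hM
    simp only [Matrix.transpose_mul, PT, KT, LT] at this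
    rwa [← mul_assoc] at this
  have ex : ∃ M, L.IsMoorePenroseInv M := by
    refine ⟨P * KM * P, ?_, ?_, ?_, ?_⟩
    · rw [hM, PL]
    · rw [hM2, ← mul_assoc, ← mul_assoc, PP]
    · rw [hM, PT]
    · rw [hM2, PT]
  set M := mpinv L with hMdef
  have hLML : L * M * L = L := by
    have : mpinv L = ex.choose := by unfold mpinv; rw [dif_pos ex]
    rw [hMdef, this]; exact ex.choose_spec.1
  have key : ∀ u v, resDist G u v = K u u - K u v - K v u + K v v := by
    intro u v
    have aux : ∀ A : Matrix V V ℝ, A u u - A u v - A v u + A v v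
        = (Pi.single u 1 - Pi.single v 1 : V → ℝ) ⬝ᵥ (A *ᵥ (Pi.single u 1 - Pi.single v 1)) := by
      intro A
      simp [Matrix.mulVec_sub, sub_dotProduct, dotProduct_sub]
      ring
    set e : V → ℝ := Pi.single u 1 - Pi.single v 1 with he
    have hQe : Q *ᵥ e = 0 := by
      ext t; simp [he, Matrix.mulVec_sub, hQ]
    have hLy : L *ᵥ (KM *ᵥ e) = e := by
      rw [Matrix.mulVec_mulVec, LK, Matrix.sub_mulVec, hQe]; simp
    have hyL : (KM *ᵥ e) ᵥ* L = e := by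
      rw [← Matrix.mulVec_transpose, LT, hLy]
    have h1 : resDist G u v = e ⬝ᵥ (M *ᵥ e) := aux M
    have h2 : K u u - K u v - K v u + K v v = e ⬝ᵥ (KM *ᵥ e) := aux KM
    rw [h1, h2]
    have : e ⬝ᵥ (M *ᵥ e) = (KM *ᵥ e) ⬝ᵥ ((L * M * L) *ᵥ (KM *ᵥ e)) := by
      rw [← Matrix.mulVec_mulVec, hLy, ← Matrix.mulVec_mulVec, Matrix.dotProduct_mulVec _ L, hyL]
    rw [this, hLML, hLy, dotProduct_comm]
  unfold kirchhoff
  simp only [key, Finset.sum_add_distrib, Finset.sum_sub_distrib, Finset.sum_const,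
    Finset.card_univ, nsmul_eq_mul]
  rw [Finset.sum_comm (f := fun u v => K v u)]
  rw [← Finset.mul_sum]
  ring

end KirchAux

section KerAux

structure Ker (o : ℕ) (E : (ℕ → ℝ) → (ℕ → ℝ) → ℝ) (K : ℕ → ℕ → ℝ) : Prop where
  loc : ∀ f f' g, (∀ j, j ≤ o → f j = f' j) → E f g = E f' g
  lin : ∀ f f' g (c d : ℝ), E (fun j => c + f j + d * f' j) g = E f g + d * E f' g
  symm : ∀ x y, K x y = K y x
  zero : ∀ x, K 0 x = 0
  rep : ∀ z, z ≤ o → ∀ g, E (K z) g = g z - g 0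
  lo : ∀ z, z ≤ o → 0 ≤ K z o
  hi : ∀ z, z ≤ o → K z o ≤ K o o

lemma Ker.shift {o E K} (h : Ker o E K) (f g : ℕ → ℝ) (c : ℝ) :
    E (fun j => c + f j) g = E f g := by
  have := h.lin f f g c 0
  simpa using this

def pathE (o : ℕ) (f g : ℕ → ℝ) : ℝ :=
  ∑ j ∈ Finset.range o, (f (j + 1) - f j) * (g (j + 1) - g j)

def pathK (x y : ℕ) : ℝ := ((min x y : ℕ) : ℝ)

lemma path_ker (o : ℕ) : Ker o (pathE o) pathK where
  loc := by
    intro f f' g h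
    unfold pathE
    refine Finset.sum_congr rfl fun j hj => ?_
    have := Finset.mem_range.1 hj
    rw [h j (by omega), h (j + 1) (by omega)]
  lin := by
    intro f f' g c d
    unfold pathE
    rw [Finset.mul_sum, ← Finset.sum_add_distrib]
    refine Finset.sum_congr rfl fun j hj => ?_
    ring
  symm := by intro x y; simp [pathK, min_comm]
  zero := by intro x; simp [pathK]
  rep := by
    intro z hz g
    have : ∀ o, pathE o (pathK z) g = g (min z o) - g 0 := by
      intro o
      induction o with
      | zero => simp [pathE]
      | succ o ih =>
        unfold pathE at ih ⊢
        rw [Finset.sum_range_succ, ih]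
        unfold pathK
        rcases le_or_gt z o with h | h
        · rw [min_eq_left h, min_eq_left (by omega : z ≤ o + 1)]; ring
        · rw [min_eq_right h.le, min_eq_right (by omega : o + 1 ≤ z)]; push_cast; ring
    rw [this, min_eq_left hz]
  lo := by intro z _; unfold pathK; positivity
  hi := by intro z hz; unfold pathK; simp [hz]

def serE (o : ℕ) (E1 E2 : (ℕ → ℝ) → (ℕ → ℝ) → ℝ) (f g : ℕ → ℝ) : ℝ :=
  E1 f g + E2 (fun j => f (o + j)) (fun j => g (o + j))

def serK (o : ℕ) (K1 K2 : ℕ → ℕ → ℝ) (x y : ℕ) : ℝ :=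
  K1 (min x o) (min y o) + K2 (x - o) (y - o)

lemma ser_ker {o1 o2 E1 E2 K1 K2} (h1 : Ker o1 E1 K1) (h2 : Ker o2 E2 K2) :
    Ker (o1 + o2) (serE o1 E1 E2) (serK o1 K1 K2) where
  loc := by
    intro f f' g h
    unfold serE
    rw [h1.loc f f' g (fun j hj => h j (by omega)),
      h2.loc _ (fun j => f' (o1 + j)) _ (fun j hj => h _ (by omega))]
  lin := by
    intro f f' g c d
    unfold serE
    rw [h1.lin, h2.lin (fun j => f (o1 + j)) (fun j => f' (o1 + j))]
    ring
  symm := by intro x y; unfold serK; rw [h1.symm, h2.symm]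
  zero := by intro x; simp [serK, h1.zero, h2.zero]
  rep := by
    intro z hz g
    unfold serE
    rw [h1.loc (serK o1 K1 K2 z) (K1 (min z o1)) g
      (by intro j hj; simp [serK, min_eq_left hj, Nat.sub_eq_zero_of_le hj, h2.symm _ 0, h2.zero])]
    rw [h2.loc (fun j => serK o1 K1 K2 z (o1 + j)) (fun j => K1 (min z o1) o1 + K2 (z - o1) j) _
      (by intro j hj; simp [serK])]
    rw [h2.shift, h1.rep _ (min_le_right _ _), h2.rep _ (by omega)]
    rcases le_total z o1 with h | h
    · rw [min_eq_left h, Nat.sub_eq_zero_of_le h]; ring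
    · rw [min_eq_right h, Nat.add_sub_cancel' h]; simp
  lo := by
    intro z hz
    unfold serK
    rw [min_eq_right (by omega : o1 ≤ o1 + o2), Nat.add_sub_cancel_left]
    exact add_nonneg (h1.lo _ (min_le_right _ _)) (h2.lo _ (by omega))
  hi := by
    intro z hz
    unfold serK
    rw [min_eq_right (by omega : o1 ≤ o1 + o2), Nat.add_sub_cancel_left]
    exact add_le_add (h1.hi _ (min_le_right _ _)) (h2.hi _ (by omega))

def cloE (o : ℕ) (E : (ℕ → ℝ) → (ℕ → ℝ) → ℝ) (f g : ℕ → ℝ) : ℝ :=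
  E f g + (f o - f 0) * (g o - g 0)

noncomputable def cloK (o : ℕ) (K : ℕ → ℕ → ℝ) (x y : ℕ) : ℝ :=
  K x y - K x o * K y o / (1 + K o o)

lemma clo_ker {o E K} (h : Ker o E K) : Ker o (cloE o E) (cloK o K) := by
  have hR : 0 ≤ K o o := h.lo o le_rfl
  have hT : (1 + K o o) ≠ 0 := by positivity
  have e : ∀ z, cloK o K z o = K z o / (1 + K o o) := by
    intro z; unfold cloK; field_simp; ring
  refine ⟨?_, ?_, ?_, ?_, ?_, ?_, ?_⟩
  · intro f f' g hh
    unfold cloE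
    rw [h.loc f f' g hh, hh o le_rfl, hh 0 (Nat.zero_le _)]
  · intro f f' g c d
    unfold cloE
    rw [h.lin]; ring
  · intro x y; unfold cloK; rw [h.symm]; ring
  · intro x; simp [cloK, h.zero]
  · intro z hz g
    unfold cloE
    rw [e z, show cloK o K z 0 = 0 by unfold cloK; rw [h.symm, h.zero, h.zero]; simp]
    have : cloK o K z = fun j => 0 + K z j + (-(K z o / (1 + K o o))) * K o j := by
      funext j; unfold cloK; rw [h.symm o j]; ring
    rw [this, h.lin, h.rep z hz, h.rep o le_rfl]; ring
  · intro z hz; rw [e]; have := h.lo z hz; positivity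
  · intro z hz; rw [e, e]; have := h.hi z hz; gcongr

lemma clo_lt {o E K} (h : Ker o E K) : cloK o K o o < 1 := by
  have hR : 0 ≤ K o o := h.lo o le_rfl
  have hT : 0 < (1 + K o o) := by positivity
  have : cloK o K o o = K o o / (1 + K o o) := by unfold cloK; field_simp; ring
  rw [this, div_lt_one hT]; linarith

def revE (o : ℕ) (E : (ℕ → ℝ) → (ℕ → ℝ) → ℝ) (f g : ℕ → ℝ) : ℝ :=
  E (fun j => f (o - j)) (fun j => g (o - j))

def revK (o : ℕ) (K : ℕ → ℕ → ℝ) (x y : ℕ) : ℝ :=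
  K (o - x) (o - y) - K (o - x) o - K (o - y) o + K o o

lemma rev_ker {o E K} (h : Ker o E K) : Ker o (revE o E) (revK o K) where
  loc := by
    intro f f' g hh
    exact h.loc _ _ _ (fun j _ => hh _ (by omega))
  lin := by
    intro f f' g c d
    exact h.lin (fun j => f (o - j)) (fun j => f' (o - j)) _ c d
  symm := by intro x y; unfold revK; rw [h.symm]; ring
  zero := by intro x; unfold revK; rw [Nat.sub_zero, h.symm o]; ring
  rep := by
    intro z hz g
    unfold revE
    rw [h.loc (fun j => revK o K z (o - j))
      (fun j => (K o o - K (o - z) o) + K (o - z) j + (-1) * K o j) _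
      (by
        intro j hj
        simp only [revK]
        rw [Nat.sub_sub_self hj, h.symm j o]; ring)]
    rw [h.lin, h.rep _ (Nat.sub_le _ _), h.rep o le_rfl]
    simp only [Nat.sub_sub_self hz, Nat.sub_self]; ring
  lo := by
    intro z hz
    unfold revK
    rw [Nat.sub_self, h.zero, h.symm _ 0, h.zero]
    have := h.hi (o - z) (Nat.sub_le _ _); linarith
  hi := by
    intro z hz
    unfold revK
    rw [Nat.sub_self, h.zero, h.symm _ 0, h.zero, h.zero]
    have := h.lo (o - z) (Nat.sub_le _ _); linarith

def chordE (m : ℕ) (x y : ℕ → ℕ) (f g : ℕ → ℝ) : ℝ :=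
  ∑ k ∈ Finset.range m, (f (y k) - f (x k)) * (g (y k) - g (x k))

def pieceE (o m : ℕ) (x y : ℕ → ℕ) (f g : ℕ → ℝ) : ℝ :=
  pathE o f g + chordE m x y f g

lemma pathE_add (a b : ℕ) (f g : ℕ → ℝ) :
    pathE (a + b) f g = pathE a f g + pathE b (fun j => f (a + j)) (fun j => g (a + j)) := by
  unfold pathE
  rw [Finset.sum_range_add]
  simp only [add_assoc]

lemma nest (X Y : ℕ → ℕ) : ∀ m, (∀ k, k < m → X (k + 1) ≤ X k ∧ Y k ≤ Y (k + 1)) →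
    X 0 ≤ Y 0 →
    ∃ K, Ker (Y m - X m) (pieceE (Y m - X m) (m + 1) (fun k => X k - X m) (fun k => Y k - X m)) K
      ∧ K (Y m - X m) (Y m - X m) < 1 := by
  intro m
  induction m with
  | zero =>
    intro _ h0
    refine ⟨_, ?_, clo_lt (path_ker (Y 0 - X 0))⟩
    convert clo_ker (path_ker (Y 0 - X 0)) using 1
    funext f g
    simp [pieceE, chordE, cloE]
  | succ m ih =>
    intro hm h0
    obtain ⟨K, hK, -⟩ := ih (fun k hk => hm k (by omega)) h0
    have hX : ∀ k, k ≤ m → X m ≤ X k ∧ Y k ≤ Y m ∧ X k ≤ Y k := by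
      intro k hk
      have h1 : ∀ d, ∀ k, k + d = m → X m ≤ X k ∧ Y k ≤ Y m := by
        intro d
        induction d with
        | zero => intro k hk; simp at hk; subst hk; simp
        | succ d ihd =>
          intro k hk
          have := ihd (k + 1) (by omega)
          have := hm k (by omega)
          omega
      have h2 : ∀ k, k ≤ m → X k ≤ Y k := by
        intro k
        induction k with
        | zero => intro _; exact h0
        | succ k ihk => intro hk; have := ihk (by omega); have := hm k (by omega); omega
      have := h1 (m - k) k (by omega)
      exact ⟨this.1, this.2, h2 k hk⟩
    have hmm := hm m (by omega)
    have hmx := hX m le_rfl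
    set a := X m - X (m + 1) with ha
    set b := Y (m + 1) - Y m with hb
    set o := Y m - X m with ho
    have hlen : Y (m + 1) - X (m + 1) = a + o + b := by omega
    have h3 := ser_ker (ser_ker (path_ker a) hK) (path_ker b)
    refine ⟨cloK (a + o + b) (serK (a + o) (serK a pathK K) pathK), ?_, ?_⟩
    rotate_left
    · rw [hlen]; exact clo_lt h3
    · rw [hlen]
      convert clo_ker h3 using 1
      funext f g
      simp only [cloE, serE, pieceE, pathE_add, chordE]
      rw [Finset.sum_range_succ _ (m + 1)]
      have : ∑ k ∈ Finset.range (m + 1), (f (Y k - X (m + 1)) - f (X k - X (m + 1))) *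
            (g (Y k - X (m + 1)) - g (X k - X (m + 1)))
          = ∑ k ∈ Finset.range (m + 1), (f (a + (Y k - X m)) - f (a + (X k - X m))) *
            (g (a + (Y k - X m)) - g (a + (X k - X m))) := by
        refine Finset.sum_congr rfl fun k hk => ?_
        have := hX k (by have := Finset.mem_range.1 hk; omega)
        rw [show Y k - X (m + 1) = a + (Y k - X m) by omega,
          show X k - X (m + 1) = a + (X k - X m) by omega]
      rw [this, hlen, Nat.sub_self]
      ring

/-- statistics -/
def sPhi (o : ℕ) (K : ℕ → ℕ → ℝ) : ℝ := ∑ z ∈ Finset.range (o + 1), K z o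
def sPsi (o : ℕ) (K : ℕ → ℕ → ℝ) : ℝ := ∑ z ∈ Finset.range (o + 1), K z o ^ 2
def sKap (o : ℕ) (K : ℕ → ℕ → ℝ) : ℝ := ∑ z ∈ Finset.range (o + 1), K z z
def sTot (o : ℕ) (K : ℕ → ℕ → ℝ) : ℝ :=
  ∑ z ∈ Finset.range (o + 1), ∑ y ∈ Finset.range (o + 1), K z y

lemma sum_split (o1 o2 : ℕ) (F : ℕ → ℝ) :
    ∑ z ∈ Finset.range (o1 + o2 + 1), F z
      = ∑ z ∈ Finset.range (o1 + 1), F z + ∑ z ∈ Finset.range o2, F (o1 + (z + 1)) := by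
  rw [show o1 + o2 + 1 = (o1 + 1) + o2 by ring, Finset.sum_range_add]
  congr 1
  refine Finset.sum_congr rfl fun z _ => ?_
  rw [show o1 + 1 + z = o1 + (z + 1) by ring]

section
variable {o1 o2 : ℕ} {E1 E2 : (ℕ → ℝ) → (ℕ → ℝ) → ℝ} {K1 K2 : ℕ → ℕ → ℝ}

lemma serK_ll {x y : ℕ} (h2 : Ker o2 E2 K2) (hx : x ≤ o1) :
    serK o1 K1 K2 x y = K1 x (min y o1) := by
  simp [serK, hx, Nat.sub_eq_zero_of_le hx, h2.zero]

lemma serK_rr (x y : ℕ) : serK o1 K1 K2 (o1 + x) (o1 + y) = K1 o1 o1 + K2 x y := by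
  simp [serK]

lemma ser_R : serK o1 K1 K2 (o1 + o2) (o1 + o2) = K1 o1 o1 + K2 o2 o2 := serK_rr _ _

lemma ser_Phi (h2 : Ker o2 E2 K2) :
    sPhi (o1 + o2) (serK o1 K1 K2) = sPhi o1 K1 + o2 * K1 o1 o1 + sPhi o2 K2 := by
  unfold sPhi
  rw [sum_split, Finset.sum_range_succ' (fun z => K2 z o2), h2.zero]
  simp only [serK_rr, Finset.sum_add_distrib, Finset.sum_const, Finset.card_range, nsmul_eq_mul]
  rw [Finset.sum_congr rfl (fun z hz => by
    rw [serK_ll h2 (by have := Finset.mem_range.1 hz; omega), min_eq_right (by omega)])]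
  ring

lemma ser_Psi (h2 : Ker o2 E2 K2) :
    sPsi (o1 + o2) (serK o1 K1 K2)
      = sPsi o1 K1 + o2 * K1 o1 o1 ^ 2 + 2 * K1 o1 o1 * sPhi o2 K2 + sPsi o2 K2 := by
  unfold sPsi sPhi
  rw [sum_split, Finset.sum_range_succ' (fun z => K2 z o2), h2.zero,
    Finset.sum_range_succ' (fun z => K2 z o2 ^ 2), h2.zero]
  simp only [serK_rr, add_sq, Finset.sum_add_distrib, Finset.sum_const, Finset.card_range,
    nsmul_eq_mul, ← Finset.mul_sum]
  rw [Finset.sum_congr rfl (fun z hz => by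
    rw [serK_ll h2 (by have := Finset.mem_range.1 hz; omega), min_eq_right (by omega)])]
  ring

lemma ser_Kap (h2 : Ker o2 E2 K2) :
    sKap (o1 + o2) (serK o1 K1 K2) = sKap o1 K1 + o2 * K1 o1 o1 + sKap o2 K2 := by
  unfold sKap
  rw [sum_split, Finset.sum_range_succ' (fun z => K2 z z), h2.zero]
  simp only [serK_rr, Finset.sum_add_distrib, Finset.sum_const, Finset.card_range, nsmul_eq_mul]
  rw [Finset.sum_congr rfl (fun z hz => by
    rw [serK_ll h2 (by have := Finset.mem_range.1 hz; omega),
      min_eq_left (by have := Finset.mem_range.1 hz; omega)])]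
  ring

lemma ser_Tot (h1 : Ker o1 E1 K1) (h2 : Ker o2 E2 K2) :
    sTot (o1 + o2) (serK o1 K1 K2)
      = sTot o1 K1 + 2 * o2 * sPhi o1 K1 + o2 ^ 2 * K1 o1 o1 + sTot o2 K2 := by
  have hs := (ser_ker h1 h2).symm
  have e1 : ∀ x, x ≤ o1 → ∀ y, serK o1 K1 K2 x (o1 + y) = K1 x o1 := by
    intro x hx y; rw [serK_ll h2 hx, min_eq_right (by omega)]
  have e2 : ∀ x, x ≤ o1 → ∀ y, y ≤ o1 → serK o1 K1 K2 x y = K1 x y := by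
    intro x hx y hy; rw [serK_ll h2 hx, min_eq_left hy]
  have e3 : sTot o2 K2 = ∑ z ∈ Finset.range o2, ∑ y ∈ Finset.range o2, K2 (z + 1) (y + 1) := by
    unfold sTot
    rw [Finset.sum_range_succ']
    simp only [h2.zero, Finset.sum_const_zero, add_zero]
    refine Finset.sum_congr rfl fun z _ => ?_
    rw [Finset.sum_range_succ', h2.symm _ 0, h2.zero, add_zero]
  rw [e3]
  unfold sTot sPhi
  rw [sum_split]
  simp only [sum_split o1 o2, Finset.sum_add_distrib, serK_rr]
  have a1 : ∑ x ∈ Finset.range (o1 + 1), ∑ y ∈ Finset.range (o1 + 1), serK o1 K1 K2 x y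
      = ∑ x ∈ Finset.range (o1 + 1), ∑ y ∈ Finset.range (o1 + 1), K1 x y :=
    Finset.sum_congr rfl fun x hx => Finset.sum_congr rfl fun y hy =>
      e2 x (by have := Finset.mem_range.1 hx; omega) y (by have := Finset.mem_range.1 hy; omega)
  have a2 : ∑ x ∈ Finset.range (o1 + 1), ∑ y ∈ Finset.range o2, serK o1 K1 K2 x (o1 + (y + 1))
      = o2 * ∑ x ∈ Finset.range (o1 + 1), K1 x o1 := by
    rw [Finset.mul_sum]
    refine Finset.sum_congr rfl fun x hx => ?_
    rw [Finset.sum_congr rfl (fun y _ => e1 x (by have := Finset.mem_range.1 hx; omega) (y + 1))]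
    simp
  have a3 : ∑ x ∈ Finset.range o2, ∑ y ∈ Finset.range (o1 + 1), serK o1 K1 K2 (o1 + (x + 1)) y
      = o2 * ∑ x ∈ Finset.range (o1 + 1), K1 x o1 := by
    rw [← a2, Finset.sum_comm]
    exact Finset.sum_congr rfl fun x _ => Finset.sum_congr rfl fun y _ => hs _ _
  rw [a1, a2, a3]
  simp only [Finset.sum_const, Finset.card_range, nsmul_eq_mul]
  ring
end

section
variable {o : ℕ} {E : (ℕ → ℝ) → (ℕ → ℝ) → ℝ} {K : ℕ → ℕ → ℝ}

lemma sum_refl (o : ℕ) (F : ℕ → ℝ) :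
    ∑ z ∈ Finset.range (o + 1), F (o - z) = ∑ z ∈ Finset.range (o + 1), F z := by
  have := Finset.sum_range_reflect F (o + 1)
  simpa using this

lemma rev_R (h : Ker o E K) : revK o K o o = K o o := by
  simp [revK, h.zero]

lemma rev_at (h : Ker o E K) (z : ℕ) : revK o K z o = K o o - K (o - z) o := by
  simp [revK, h.zero, h.symm _ 0]; ring

lemma rev_Phi (h : Ker o E K) : sPhi o (revK o K) = (o + 1) * K o o - sPhi o K := by
  unfold sPhi
  simp only [rev_at h]
  rw [sum_refl o (fun z => K o o - K z o)]
  simp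

lemma rev_Psi (h : Ker o E K) :
    sPsi o (revK o K) = (o + 1) * K o o ^ 2 - 2 * K o o * sPhi o K + sPsi o K := by
  unfold sPsi sPhi
  simp only [rev_at h]
  rw [sum_refl o (fun z => (K o o - K z o) ^ 2)]
  simp only [sub_sq, Finset.sum_add_distrib, Finset.sum_sub_distrib, ← Finset.mul_sum]
  simp

lemma rev_Kap : sKap o (revK o K) = sKap o K - 2 * sPhi o K + (o + 1) * K o o := by
  unfold sKap sPhi revK
  rw [sum_refl o (fun z => K z z - K z o - K z o + K o o)]
  simp only [Finset.sum_add_distrib, Finset.sum_sub_distrib]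
  simp; ring

lemma rev_Tot :
    sTot o (revK o K) = sTot o K - 2 * (o + 1) * sPhi o K + (o + 1) ^ 2 * K o o := by
  unfold sTot sPhi revK
  rw [sum_refl o (fun z => ∑ y ∈ Finset.range (o + 1), (K z (o - y) - K z o - K (o - y) o + K o o))]
  rw [Finset.sum_congr rfl (fun z _ => sum_refl o (fun y => K z y - K z o - K y o + K o o))]
  simp only [Finset.sum_add_distrib, Finset.sum_sub_distrib, Finset.sum_const, Finset.card_range,
    nsmul_eq_mul, ← Finset.mul_sum]
  push_cast
  ring

lemma phi_bounds (h : Ker o E K) (ho : 1 ≤ o) (hR : K o o < 1) :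
    2 * sPhi o K < o + o * K o o ∧ (o + 2) * K o o - o < 2 * sPhi o K := by
  have ho' : (1 : ℝ) ≤ o := by exact_mod_cast ho
  have h0 := h.lo o le_rfl
  have u : sPhi o K ≤ o * K o o := by
    unfold sPhi
    rw [Finset.sum_range_succ', h.zero, add_zero]
    have := Finset.sum_le_card_nsmul (Finset.range o) (fun k => K (k + 1) o) (K o o)
      (fun k hk => h.hi _ (by have := Finset.mem_range.1 hk; omega))
    simpa using this
  have l : K o o ≤ sPhi o K := by
    unfold sPhi
    rw [Finset.sum_range_succ]
    have := Finset.sum_nonneg (s := Finset.range o) (f := fun k => K k o)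
      (fun k hk => h.lo _ (by have := Finset.mem_range.1 hk; omega))
    linarith
  have p : 0 < (o : ℝ) * (1 - K o o) := mul_pos (by linarith) (by linarith)
  constructor <;> nlinarith

end

/-- Kirchhoff index of the loop closure. -/
noncomputable def kfc (o : ℕ) (K : ℕ → ℕ → ℝ) : ℝ :=
  (o + 1) * (sKap o K - sPsi o K / (1 + K o o)) - (sTot o K - sPhi o K ^ 2 / (1 + K o o))

lemma kfc_eq (o : ℕ) (K : ℕ → ℕ → ℝ) :
    ((o : ℝ) + 1) * ∑ z ∈ Finset.range (o + 1), cloK o K z z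
      - ∑ z ∈ Finset.range (o + 1), ∑ y ∈ Finset.range (o + 1), cloK o K z y = kfc o K := by
  unfold kfc cloK sKap sPsi sTot sPhi
  simp only [Finset.sum_sub_distrib, ← Finset.sum_div, ← Finset.mul_sum, ← Finset.sum_mul, sq]

lemma path_stats (o : ℕ) (ho : o ≤ 5) :
    sPhi o pathK = o * (o + 1) / 2 ∧ sPsi o pathK = o * (o + 1) * (2 * o + 1) / 6 ∧
    sKap o pathK = o * (o + 1) / 2 ∧ sTot o pathK = o * (o + 1) * (2 * o + 1) / 6 ∧
    pathK o o = o := by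
  unfold sPhi sPsi sKap sTot pathK
  interval_cases o <;> norm_num [Finset.sum_range_succ]

def assembleK (oA a oB : ℕ) (KA KB : ℕ → ℕ → ℝ) : ℕ → ℕ → ℝ :=
  serK (oA + a + oB) (serK (oA + a) (serK oA KA pathK) KB) pathK

lemma assemble_ker {oA a oB b : ℕ} {EA EB KA KB} (hA : Ker oA EA KA) (hB : Ker oB EB KB) :
    Ker (oA + a + oB + b)
      (serE (oA + a + oB) (serE (oA + a) (serE oA EA (pathE a)) EB) (pathE b))
      (assembleK oA a oB KA KB) :=
  ser_ker (ser_ker (ser_ker hA (path_ker a)) hB) (path_ker b)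

lemma kfc_assemble {oA a oB b : ℕ} {EA EB KA KB} (hA : Ker oA EA KA) (hB : Ker oB EB KB)
    (ha : a ≤ 5) (hb : b ≤ 5) (k : ℝ) (hk : kfc (oA + a + oB + b) (assembleK oA a oB KA KB) = k) :
    (1 + KA oA oA + a + KB oB oB + b) * k =
      (oA + a + oB + b + 1) * ((1 + KA oA oA + a + KB oB oB + b) *
        (sKap oA KA + a * KA oA oA + a * (a + 1) / 2 + oB * (KA oA oA + a) + sKap oB KB
          + b * (KA oA oA + a + KB oB oB) + b * (b + 1) / 2)
        - (sPsi oA KA + a * KA oA oA ^ 2 + 2 * KA oA oA * (a * (a + 1) / 2)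
          + a * (a + 1) * (2 * a + 1) / 6
          + oB * (KA oA oA + a) ^ 2 + 2 * (KA oA oA + a) * sPhi oB KB + sPsi oB KB
          + b * (KA oA oA + a + KB oB oB) ^ 2
          + 2 * (KA oA oA + a + KB oB oB) * (b * (b + 1) / 2) + b * (b + 1) * (2 * b + 1) / 6))
      - ((1 + KA oA oA + a + KB oB oB + b) *
        (sTot oA KA + 2 * a * sPhi oA KA + a ^ 2 * KA oA oA + a * (a + 1) * (2 * a + 1) / 6
          + 2 * oB * (sPhi oA KA + a * KA oA oA + a * (a + 1) / 2)
          + oB ^ 2 * (KA oA oA + a) + sTot oB KB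
          + 2 * b * (sPhi oA KA + a * KA oA oA + a * (a + 1) / 2 + oB * (KA oA oA + a) + sPhi oB KB)
          + b ^ 2 * (KA oA oA + a + KB oB oB) + b * (b + 1) * (2 * b + 1) / 6)
        - (sPhi oA KA + a * KA oA oA + a * (a + 1) / 2 + oB * (KA oA oA + a) + sPhi oB KB
          + b * (KA oA oA + a + KB oB oB) + b * (b + 1) / 2) ^ 2) := by
  subst hk
  obtain ⟨p1, p2, p3, p4, p5⟩ := path_stats a ha
  obtain ⟨q1, q2, q3, q4, q5⟩ := path_stats b hb
  have s1 := ser_ker hA (path_ker a)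
  have s2 := ser_ker s1 hB
  have pa := path_ker a
  have pb := path_ker b
  unfold kfc assembleK
  rw [ser_Phi pb, ser_Psi pb, ser_Kap pb, ser_Tot s2 pb, ser_R,
    ser_Phi hB, ser_Kap hB, ser_Psi hB, ser_Tot s1 hB, ser_R,
    ser_Phi pa, ser_Kap pa, ser_Psi pa, ser_Tot hA pa, ser_R,
    p1, p2, p3, p4, p5, q1, q2, q3, q4, q5]
  simp only [ser_R, p5]
  have hA0 := hA.lo oA le_rfl
  have hB0 := hB.lo oB le_rfl
  have hT : 1 + KA oA oA + a + KB oB oB + b ≠ 0 := by positivity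
  have gen : ∀ T N x y z t : ℝ, T ≠ 0 →
      T * (N * (x - y / T) - (z - t ^ 2 / T)) = N * (T * x - y) - (T * z - t ^ 2) := by
    intro T N x y z t h
    field_simp
  have e1 : 1 + (KA oA oA + (a : ℝ) + KB oB oB + (b : ℝ)) = 1 + KA oA oA + a + KB oB oB + b := by
    ring
  rw [e1, gen _ _ _ _ _ _ hT]
  push_cast
  ring

lemma kfc_lt {oA oB : ℕ} {EA EB KA KB} (hA : Ker oA EA KA) (hB : Ker oB EB KB)
    (ha1 : 1 ≤ oA) (hb1 : 1 ≤ oB) (hRA : KA oA oA < 1) (hRB : KB oB oB < 1) (a b : ℕ)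
    (hab : (a = 1 ∧ b = 4) ∨ (a = 5 ∧ b = 0)) :
    kfc (oA + a + oB + b) (assembleK oA a oB KA KB) <
      kfc (oA + 4 + oB + 1) (assembleK oA 4 oB KA (revK oB KB)) := by
  have hA0 := hA.lo oA le_rfl
  have hB0 := hB.lo oB le_rfl
  obtain ⟨A1, A2⟩ := phi_bounds hA ha1 hRA
  obtain ⟨B1, B2⟩ := phi_bounds hB hb1 hRB
  have f2 := kfc_assemble (a := 4) (b := 1) hA (rev_ker hB) (by norm_num) (by norm_num) _ rfl
  set k2 := kfc (oA + 4 + oB + 1) (assembleK oA 4 oB KA (revK oB KB))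
  rw [rev_R hB, rev_Phi hB, rev_Psi hB, rev_Kap, rev_Tot] at f2
  have ha1' : (1 : ℝ) ≤ oA := by exact_mod_cast ha1
  have hb1' : (1 : ℝ) ≤ oB := by exact_mod_cast hb1
  rcases hab with ⟨rfl, rfl⟩ | ⟨rfl, rfl⟩
  · have f1 := kfc_assemble (a := 1) (b := 4) hA hB (by norm_num) (by norm_num) _ rfl
    set k1 := kfc (oA + 1 + oB + 4) (assembleK oA 1 oB KA KB)
    generalize KA oA oA = RA at *
    generalize KB oB oB = RB at *
    generalize sPhi oA KA = PA at *
    generalize sPhi oB KB = PB at *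
    push_cast at f1 f2
    have hT : 0 < 11 + RA + RB - 5 := by linarith
    have key : (11 + RA + RB - 5) * (k2 - k1) = ((oA - RA) - ((oA + 1) * RA - 2 * PA)) * (3 * (oB - RB) - (2 * PB - (oB + 1) * RB)) := by
      linear_combination f2 - f1
    have pos : 0 < (11 + RA + RB - 5) * (k2 - k1) := by
      rw [key]
      apply mul_pos <;> linarith
    have := (mul_pos_iff_of_pos_left hT).1 pos
    linarith
  · have f1 := kfc_assemble (a := 5) (b := 0) hA hB (by norm_num) (by norm_num) _ rfl
    set k1 := kfc (oA + 5 + oB + 0) (assembleK oA 5 oB KA KB)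
    generalize KA oA oA = RA at *
    generalize KB oB oB = RB at *
    generalize sPhi oA KA = PA at *
    generalize sPhi oB KB = PB at *
    push_cast at f1 f2
    have hT : 0 < 11 + RA + RB - 5 := by linarith
    have key : (11 + RA + RB - 5) * (k2 - k1) = (3 * (oA - RA) + ((oA + 1) * RA - 2 * PA)) * ((oB - RB) + (2 * PB - (oB + 1) * RB)) := by
      linear_combination f2 - f1
    have pos : 0 < (11 + RA + RB - 5) * (k2 - k1) := by
      rw [key]
      apply mul_pos <;> linarith
    have := (mul_pos_iff_of_pos_left hT).1 pos
    linarith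

end KerAux

section GraphAux

def cumT (n : ℕ) (w : Fin (n - 2) → Fin 5) (k : ℕ) : ℕ :=
  ∑ j ∈ Finset.univ.filter (fun j : Fin (n - 2) => (j : ℕ) < k), ((w j : ℕ))

def tp (T : ℕ → ℕ) (k : ℕ) : ℕ := k + 1 + T k
def bp (n : ℕ) (T : ℕ → ℕ) (k : ℕ) : ℕ := n + 6 + T k + 5 * (n - 2 - k)

lemma tpos_eq (n : ℕ) (w : Fin (n - 2) → Fin 5) (k : ℕ) :
    tpos n w (k + 1) = tp (cumT n w) k := by
  unfold tpos tp cumT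
  simp only [Nat.add_lt_add_iff_right]

lemma card_ge (m k : ℕ) : (Finset.univ.filter (fun j : Fin m => k ≤ (j : ℕ))).card = m - k := by
  have h1 : (Finset.univ.filter (fun j : Fin m => k ≤ (j : ℕ))).card
      = ((Finset.range m).filter (fun j => k ≤ j)).card := by
    rw [Finset.card_filter, Finset.card_filter, Fin.sum_univ_eq_sum_range (fun j => if k ≤ j then 1 else 0)]
  rw [h1, show (Finset.range m).filter (fun j => k ≤ j) = Finset.Ico k m by
    ext x; simp [and_comm]]
  simp

lemma bpos_eq (n : ℕ) (w : Fin (n - 2) → Fin 5) (k : ℕ) :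
    bpos n w (k + 1) = bp n (cumT n w) k := by
  unfold bpos bp cumT
  simp only [Nat.add_le_add_iff_right]
  have h1 : ∑ j, (w j : ℕ) = ∑ j ∈ Finset.univ.filter (fun j : Fin (n - 2) => (j : ℕ) < k), (w j : ℕ)
      + ∑ j ∈ Finset.univ.filter (fun j : Fin (n - 2) => k ≤ (j : ℕ)), (w j : ℕ) := by
    rw [← Finset.sum_filter_add_sum_filter_not Finset.univ (fun j : Fin (n - 2) => (j : ℕ) < k)]
    simp only [not_lt]
  have h2 : ∑ j ∈ Finset.univ.filter (fun j : Fin (n - 2) => k ≤ (j : ℕ)), (w j : ℕ)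
      + ∑ j ∈ Finset.univ.filter (fun j : Fin (n - 2) => k ≤ (j : ℕ)), (5 - (w j : ℕ))
      = 5 * (n - 2 - k) := by
    rw [← Finset.sum_add_distrib, Finset.sum_congr rfl (fun j _ =>
      (by have := (w j).isLt; omega : (w j : ℕ) + (5 - (w j : ℕ)) = 5))]
    simp [card_ge, mul_comm]
  omega

lemma cumT_zero (n : ℕ) (w : Fin (n - 2) → Fin 5) : cumT n w 0 = 0 := by simp [cumT]

lemma cumT_succ (n : ℕ) (w : Fin (n - 2) → Fin 5) (k : ℕ) (hk : k < n - 2) :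
    cumT n w (k + 1) = cumT n w k + (w ⟨k, hk⟩ : ℕ) := by
  unfold cumT
  have : Finset.univ.filter (fun j : Fin (n - 2) => (j : ℕ) < k + 1)
      = insert ⟨k, hk⟩ (Finset.univ.filter (fun j : Fin (n - 2) => (j : ℕ) < k)) := by
    ext j; simp [Fin.ext_iff]; omega
  rw [this, Finset.sum_insert (by simp)]
  ring

lemma cumT_mono (n : ℕ) (w : Fin (n - 2) → Fin 5) {k l : ℕ} (h : k ≤ l) :
    cumT n w k ≤ cumT n w l := by
  unfold cumT
  refine Finset.sum_le_sum_of_subset fun j hj => ?_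
  simp at hj ⊢; omega

lemma cumT_le (n : ℕ) (w : Fin (n - 2) → Fin 5) (k : ℕ) (hk : k ≤ n - 2) :
    cumT n w k ≤ 4 * k := by
  induction k with
  | zero => simp [cumT_zero]
  | succ k ih =>
    rw [cumT_succ n w k hk]
    have := ih (by omega)
    have := (w ⟨k, hk⟩).isLt
    omega

lemma tp_lt (n : ℕ) (w : Fin (n - 2) → Fin 5) (k : ℕ) (hk : k + 1 < n) :
    tp (cumT n w) k + 7 ≤ bp n (cumT n w) k ∧ bp n (cumT n w) k < 6 * n + 2 - 5 ∧
      1 ≤ tp (cumT n w) k := by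
  have := cumT_le n w k (by omega)
  unfold tp bp
  omega

/-- periodic extension -/
def per {N : ℕ} (hN : 0 < N) (f : Fin N → ℝ) (j : ℕ) : ℝ := f ⟨j % N, Nat.mod_lt _ hN⟩

lemma per_val {N : ℕ} (hN : 0 < N) (f : Fin N → ℝ) (u : Fin N) : per hN f u = f u := by
  unfold per; congr 1; ext; exact Nat.mod_eq_of_lt u.isLt

lemma per_add {N : ℕ} (hN : 0 < N) (f : Fin N → ℝ) (j : ℕ) : per hN f (N + j) = per hN f j := by
  unfold per; congr 1; ext; simp

set_option maxHeartbeats 2000000 in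
open Classical in
lemma octForm (n : ℕ) (hn : 3 ≤ n) (w : Fin (n - 2) → Fin 5) (hN : 0 < 6 * n + 2)
    (f g : Fin (6 * n + 2) → ℝ) :
    ∑ u, ∑ v, glap (octChain n w) u v * f v * g u
      = pathE (6 * n + 2) (per hN f) (per hN g)
        + chordE (n - 1) (tp (cumT n w)) (bp n (cumT n w)) (per hN f) (per hN g) := by
  set t := tp (cumT n w) with ht
  set b := bp n (cumT n w) with hb
  rw [glap_form]
  set D : Fin (6 * n + 2) → Fin (6 * n + 2) → ℝ := fun u v => (f u - f v) * (g u - g v) with hD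
  have Dsymm : ∀ u v, D u v = D v u := by intro u v; simp only [hD]; ring
  let R1 : Fin (6 * n + 2) → Fin (6 * n + 2) → Prop :=
    fun u v => v = ⟨((u : ℕ) + 1) % (6 * n + 2), Nat.mod_lt _ hN⟩
  let R3 : Fin (6 * n + 2) → Fin (6 * n + 2) → Prop :=
    fun u v => ∃ k, k < n - 1 ∧ (u : ℕ) = t k ∧ (v : ℕ) = b k
  have hR1 : ∀ u v, R1 u v ↔
      ((u : ℕ) + 1 = (v : ℕ)) ∨ ((u : ℕ) = 6 * n + 1 ∧ (v : ℕ) = 0) := by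
    intro u v
    simp only [R1, Fin.ext_iff]
    have hu := u.isLt
    have hv := v.isLt
    rcases Nat.lt_or_ge ((u : ℕ) + 1) (6 * n + 2) with h | h
    · rw [Nat.mod_eq_of_lt h]; omega
    · have : (u : ℕ) + 1 = 6 * n + 2 := by omega
      rw [this, Nat.mod_self]; omega
  have hR3 : ∀ u v, R3 u v ↔ ∃ k, 1 ≤ k ∧ k ≤ n - 1 ∧ (u : ℕ) = tpos n w k ∧ (v : ℕ) = bpos n w k := by
    intro u v
    constructor
    · rintro ⟨k, hk, h1, h2⟩
      exact ⟨k + 1, by omega, by omega, by rw [tpos_eq]; exact h1, by rw [bpos_eq]; exact h2⟩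
    · rintro ⟨k, hk1, hk, h1, h2⟩
      obtain ⟨k, rfl⟩ : ∃ k', k = k' + 1 := ⟨k - 1, by omega⟩
      rw [tpos_eq] at h1
      rw [bpos_eq] at h2
      exact ⟨k, by omega, h1, h2⟩
  have hadj : ∀ u v, (octChain n w).Adj u v ↔ u ≠ v ∧ ((R1 u v ∨ R3 u v) ∨ (R1 v u ∨ R3 v u)) := by
    intro u v
    unfold octChain
    rw [SimpleGraph.fromRel_adj, hR1, hR1, hR3, hR3]
    simp only [or_assoc]
  have h3 : ∀ u v, R3 u v → (u : ℕ) + 7 ≤ v ∧ (v : ℕ) + 5 < 6 * n + 2 ∧ 1 ≤ (u : ℕ) := by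
    rintro u v ⟨k, hk, h1, h2⟩
    have := tp_lt n w k (by omega)
    rw [← ht, ← hb] at this
    rw [h1, h2]; omega
  have pt : ∀ u v, (if (octChain n w).Adj u v then (f u - f v) * (g u - g v) else 0)
      = (if R1 u v then D u v else 0) + (if R3 u v then D u v else 0)
        + ((if R1 v u then D v u else 0) + (if R3 v u then D v u else 0)) := by
    intro u v
    have a1 := hR1 u v
    have a2 := hR1 v u
    have b1 := h3 u v
    have b2 := h3 v u
    have ad := hadj u v
    have hu := u.isLt
    have hv := v.isLt
    rw [← Dsymm u v]
    have hne : u = v ↔ (u : ℕ) = v := Fin.ext_iff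
    change (if (octChain n w).Adj u v then D u v else 0) = _
    by_cases c1 : R1 u v
    · have n1 : ¬ R3 u v := by intro h; have := b1 h; have := a1.1 c1; omega
      have n2 : ¬ R3 v u := by intro h; have := b2 h; have := a1.1 c1; omega
      have n3 : ¬ R1 v u := by intro h; have := a2.1 h; have := a1.1 c1; omega
      have : (octChain n w).Adj u v := ad.2 ⟨by rw [Ne, hne]; have := a1.1 c1; omega, Or.inl (Or.inl c1)⟩
      simp [c1, n1, n2, n3, this]
    by_cases c2 : R1 v u
    · have n1 : ¬ R3 u v := by intro h; have := b1 h; have := a2.1 c2; omega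
      have n2 : ¬ R3 v u := by intro h; have := b2 h; have := a2.1 c2; omega
      have : (octChain n w).Adj u v := ad.2 ⟨by rw [Ne, hne]; have := a2.1 c2; omega, Or.inr (Or.inl c2)⟩
      simp [c1, n1, n2, c2, this]
    by_cases c3 : R3 u v
    · have n2 : ¬ R3 v u := by intro h; have := b2 h; have := b1 c3; omega
      have : (octChain n w).Adj u v := ad.2 ⟨by rw [Ne, hne]; have := b1 c3; omega, Or.inl (Or.inr c3)⟩
      simp [c1, n2, c2, c3, this]
    by_cases c4 : R3 v u
    · have : (octChain n w).Adj u v := ad.2 ⟨by rw [Ne, hne]; have := b2 c4; omega, Or.inr (Or.inr c4)⟩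
      simp [c1, c4, c2, c3, this]
    · have : ¬ (octChain n w).Adj u v := by
        rw [ad]; rintro ⟨_, (h | h) | (h | h)⟩
        exacts [c1 h, c3 h, c2 h, c4 h]
      simp [c1, c4, c2, c3, this]
  have sum1 : ∑ u, ∑ v, (if R1 u v then D u v else 0)
      = pathE (6 * n + 2) (per hN f) (per hN g) := by
    unfold pathE
    rw [← Fin.sum_univ_eq_sum_range (fun j => (per hN f (j + 1) - per hN f j) *
      (per hN g (j + 1) - per hN g j))]
    refine Finset.sum_congr rfl fun u _ => ?_
    rw [Finset.sum_eq_single (⟨((u : ℕ) + 1) % (6 * n + 2), Nat.mod_lt _ hN⟩ : Fin (6 * n + 2))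
      (fun v _ hv => if_neg hv) (fun h => absurd (Finset.mem_univ _) h), if_pos rfl]
    rw [per_val, per_val]
    simp only [hD, per]
    ring
  have tinj : ∀ k l, t k = t l → k = l := by
    intro k l h
    simp only [ht, tp] at h
    rcases le_total k l with hh | hh
    · have := cumT_mono n w hh; omega
    · have := cumT_mono n w hh; omega
  have sum3 : ∑ u, ∑ v, (if R3 u v then D u v else 0)
      = chordE (n - 1) t b (per hN f) (per hN g) := by
    have e : ∀ u v, (if R3 u v then D u v else 0)
        = ∑ k ∈ Finset.range (n - 1), if (u : ℕ) = t k then (if (v : ℕ) = b k then D u v else 0) else 0 := by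
      intro u v
      by_cases h : R3 u v
      · rw [if_pos h]
        obtain ⟨k, hk, h1, h2⟩ := h
        rw [Finset.sum_eq_single k]
        · rw [if_pos h1, if_pos h2]
        · intro l _ hl
          rw [if_neg]
          intro h'
          exact hl (tinj _ _ (h'.symm.trans h1))
        · intro h'; exact absurd (Finset.mem_range.2 hk) h'
      · rw [if_neg h]
        symm
        refine Finset.sum_eq_zero fun k hk => ?_
        by_cases h1 : (u : ℕ) = t k
        · rw [if_pos h1, if_neg]
          intro h2
          exact h ⟨k, Finset.mem_range.1 hk, h1, h2⟩
        · rw [if_neg h1]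
    simp only [e]
    rw [Finset.sum_congr rfl (fun u _ => Finset.sum_comm), Finset.sum_comm]
    unfold chordE
    refine Finset.sum_congr rfl fun k hk => ?_
    have hk' := tp_lt n w k (by have := Finset.mem_range.1 hk; omega)
    rw [← ht, ← hb] at hk'
    have ht' : t k < 6 * n + 2 := by omega
    have hb' : b k < 6 * n + 2 := by omega
    have q1 : ∀ u : Fin (6 * n + 2), (u : ℕ) = t k ↔ u = ⟨t k, ht'⟩ := by
      intro u; rw [Fin.ext_iff]
    have q2 : ∀ u : Fin (6 * n + 2), (u : ℕ) = b k ↔ u = ⟨b k, hb'⟩ := by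
      intro u; rw [Fin.ext_iff]
    simp only [q1, q2]
    rw [Finset.sum_comm]
    simp only [Finset.sum_ite_eq', Finset.mem_univ, if_true]
    simp only [hD, per, Nat.mod_eq_of_lt ht', Nat.mod_eq_of_lt hb']
    ring
  have swap : ∀ H : Fin (6 * n + 2) → Fin (6 * n + 2) → ℝ,
      ∑ u, ∑ v, H v u = ∑ u, ∑ v, H u v := fun H => Finset.sum_comm
  simp only [pt, Finset.sum_add_distrib]
  rw [swap (fun u v => if R1 u v then D u v else 0), swap (fun u v => if R3 u v then D u v else 0),
    sum1, sum3]
  ring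

def EA (n : ℕ) (T : ℕ → ℕ) (i : ℕ) : (ℕ → ℝ) → (ℕ → ℝ) → ℝ :=
  pieceE (6 * n + 2 + tp T i - bp n T i) (i + 1) (fun k => bp n T k - bp n T i)
    (fun k => 6 * n + 2 + tp T k - bp n T i)

def EB (n : ℕ) (T : ℕ → ℕ) (i : ℕ) : (ℕ → ℝ) → (ℕ → ℝ) → ℝ :=
  pieceE (bp n T (i + 1) - tp T (i + 1)) (n - 2 - i) (fun k => tp T (n - 2 - k) - tp T (i + 1))
    (fun k => bp n T (n - 2 - k) - tp T (i + 1))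

lemma pathE_rot (N β : ℕ) (hβ : β ≤ N) (F G : ℕ → ℝ) (hF : ∀ j, F (N + j) = F j)
    (hG : ∀ j, G (N + j) = G j) :
    pathE N (fun j => F (β + j)) (fun j => G (β + j)) = pathE N F G := by
  have h1 := pathE_add β N F G
  have h2 := pathE_add N β F G
  simp only [hF, hG] at h2
  rw [add_comm β N] at h1
  linarith

lemma steps (n : ℕ) (w : Fin (n - 2) → Fin 5) (k : ℕ) (hk : k < n - 2) :
    tp (cumT n w) (k + 1) = tp (cumT n w) k + (w ⟨k, hk⟩ : ℕ) + 1 ∧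
    bp n (cumT n w) k = bp n (cumT n w) (k + 1) + (5 - (w ⟨k, hk⟩ : ℕ)) := by
  unfold tp bp
  rw [cumT_succ n w k hk]
  have := (w ⟨k, hk⟩).isLt
  omega

lemma mono_tb (n : ℕ) (w : Fin (n - 2) → Fin 5) (k l : ℕ) (hkl : k ≤ l) (hl : l ≤ n - 2) :
    tp (cumT n w) k ≤ tp (cumT n w) l ∧ bp n (cumT n w) l ≤ bp n (cumT n w) k := by
  induction l with
  | zero => obtain rfl : k = 0 := by omega
            simp
  | succ l ih =>
    rcases Nat.lt_or_ge k (l + 1) with h | h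
    · have := ih (by omega) (by omega)
      have := steps n w l (by omega)
      omega
    · obtain rfl : k = l + 1 := by omega
      simp

lemma main1 (n : ℕ) (hn : 3 ≤ n) (w : Fin (n - 2) → Fin 5) (i : Fin (n - 2)) (KA KB : ℕ → ℕ → ℝ)
    (oA oB : ℕ) (hoA : oA = 6 * n + 2 + tp (cumT n w) i - bp n (cumT n w) i)
    (hoB : oB = bp n (cumT n w) (i + 1) - tp (cumT n w) (i + 1))
    (hA : Ker oA (EA n (cumT n w) i) KA) (hB : Ker oB (EB n (cumT n w) i) KB) :
    kirchhoff (octChain n w) = kfc (oA + ((w i : ℕ) + 1) + oB + (4 - (w i : ℕ)))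
      (assembleK oA ((w i : ℕ) + 1) oB KA KB) := by
  have hN : 0 < 6 * n + 2 := by omega
  set t := tp (cumT n w) with ht
  set b := bp n (cumT n w) with hb
  have hi := i.isLt
  have st := steps n w i hi
  simp only [Fin.eta] at st
  rw [← ht, ← hb] at st
  have l1 := tp_lt n w i (by omega)
  have l2 := tp_lt n w (i + 1) (by omega)
  rw [← ht, ← hb] at l1 l2
  have hw := (w i).isLt
  set a := (w i : ℕ) + 1 with ha
  set b' := 4 - (w i : ℕ) with hb'
  have hlen : oA + a + oB + b' + 1 = 6 * n + 2 := by omega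
  have hK := clo_ker (assemble_ker (a := a) (b := b') hA hB)
  set o := oA + a + oB + b' with ho
  set KK := cloK o (assembleK oA a oB KA KB) with hKK
  have decomp : ∀ F G : ℕ → ℝ, (∀ j, F (6 * n + 2 + j) = F j) → (∀ j, G (6 * n + 2 + j) = G j) →
      pathE (6 * n + 2) F G + chordE (n - 1) t b F G
        = cloE o (serE (oA + a + oB) (serE (oA + a) (serE oA (EA n (cumT n w) i) (pathE a))
            (EB n (cumT n w) i)) (pathE b')) (fun j => F (b i + j)) (fun j => G (b i + j)) := by
    intro F G hF hG
    rw [← pathE_rot (6 * n + 2) (b i) (by omega) F G hF hG, ← hlen]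
    rw [pathE_add o 1, ho, pathE_add _ b', pathE_add _ oB, pathE_add _ a, ← ho]
    simp only [cloE, serE, EA, EB, pieceE, ← ht, ← hb, ← hoA, ← hoB]
    have c1 : pathE 1 (fun j => F (b i + (o + j))) (fun j => G (b i + (o + j)))
        = (F (b i + o) - F (b i + 0)) * (G (b i + o) - G (b i + 0)) := by
      simp only [pathE, Finset.sum_range_one]
      rw [show b i + (o + (0 + 1)) = 6 * n + 2 + (b i + 0) by omega, hF, hG, add_zero o]
      ring
    have c2 : chordE (n - 1) t b F G
        = chordE (i + 1) (fun k => b k - b i) (fun k => 6 * n + 2 + t k - b i)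
            (fun j => F (b i + j)) (fun j => G (b i + j))
          + chordE (n - 2 - i) (fun k => t (n - 2 - k) - t (i + 1))
            (fun k => b (n - 2 - k) - t (i + 1))
            (fun j => F (b i + (oA + a + j))) (fun j => G (b i + (oA + a + j))) := by
      unfold chordE
      rw [show n - 1 = (i + 1) + (n - 2 - i) by omega, Finset.sum_range_add]
      congr 1
      · refine Finset.sum_congr rfl fun k hk => ?_
        have hk := Finset.mem_range.1 hk
        have m := mono_tb n w k i (by omega) (by omega)
        rw [← ht, ← hb] at m
        beta_reduce
        rw [show b i + (b k - b i) = b k by omega,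
          show b i + (6 * n + 2 + t k - b i) = 6 * n + 2 + t k by omega, hF, hG]
        ring
      · rw [← Finset.sum_range_reflect]
        refine Finset.sum_congr rfl fun k hk => ?_
        have hk := Finset.mem_range.1 hk
        rw [show (i : ℕ) + 1 + (n - 2 - i - 1 - k) = n - 2 - k by omega]
        have m := mono_tb n w (i + 1) (n - 2 - k) (by omega) (by omega)
        have l3 := tp_lt n w (n - 2 - k) (by omega)
        rw [← ht, ← hb] at m l3
        beta_reduce
        rw [show b i + (oA + a + (b (n - 2 - k) - t (i + 1))) = 6 * n + 2 + b (n - 2 - k) by omega,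
          show b i + (oA + a + (t (n - 2 - k) - t (i + 1))) = 6 * n + 2 + t (n - 2 - k) by omega,
          hF, hG, hF, hG]
    rw [c1, c2]
    ring
  -- shifted labels
  let s : Fin (6 * n + 2) → ℕ := fun u => (((u - (⟨b i, by omega⟩ : Fin (6 * n + 2)) : Fin (6 * n + 2))) : ℕ)
  have hs_lt : ∀ u, s u < 6 * n + 2 := fun u => Fin.isLt _
  have hs_val : ∀ u, s u = (6 * n + 2 - b i + (u : ℕ)) % (6 * n + 2) := fun u => Fin.val_sub _ _
  have hs1 : ∀ u, (b i + s u) % (6 * n + 2) = u := by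
    intro u
    rw [hs_val, Nat.add_mod_mod, show b i + (6 * n + 2 - b i + (u : ℕ)) = 6 * n + 2 + u by omega,
      Nat.add_mod_left, Nat.mod_eq_of_lt u.isLt]
  have hs2 : ∀ j, j < 6 * n + 2 → s ⟨(b i + j) % (6 * n + 2), Nat.mod_lt _ hN⟩ = j := by
    intro j hj
    rw [hs_val, Nat.add_mod_mod, show 6 * n + 2 - b i + (b i + j) = 6 * n + 2 + j by omega,
      Nat.add_mod_left, Nat.mod_eq_of_lt hj]
  have hsum : ∀ H : ℕ → ℝ, ∑ u, H (s u) = ∑ j ∈ Finset.range (6 * n + 2), H j := by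
    intro H
    rw [← Fin.sum_univ_eq_sum_range H]
    exact Equiv.sum_comp (Equiv.subRight (⟨b i, by omega⟩ : Fin (6 * n + 2))) (fun u => H (u : ℕ))
  rw [kirchhoff_eq (octChain n w) (fun u v => KK (s u) (s v)) (fun u v => hK.symm _ _)
    ⟨b i, by omega⟩ ?_]
  · rw [← kfc_eq, hlen, ← hKK]
    rw [hsum (fun j => KK j j)]
    rw [Finset.sum_congr rfl (fun u _ => hsum (fun j => KK (s u) j))]
    rw [hsum (fun z => ∑ j ∈ Finset.range (6 * n + 2), KK z j)]
    have : ((Fintype.card (Fin (6 * n + 2)) : ℕ) : ℝ) = (o : ℝ) + 1 := by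
      rw [Fintype.card_fin, ← hlen]; push_cast; ring
    rw [this]
  · intro z g
    rw [octForm n hn w hN, ← ht, ← hb, decomp _ _ (per_add hN _) (per_add hN _)]
    rw [hK.loc _ (KK (s z)) _ ?_, hK.rep (s z) (by have := hs_lt z; omega)]
    · simp only [per, hs1, add_zero]
      congr 2
      ext
      exact Nat.mod_eq_of_lt (by omega)
    · intro j hj
      simp only [per]
      rw [hs2 j (by omega)]

lemma exA (n : ℕ) (hn : 3 ≤ n) (w : Fin (n - 2) → Fin 5) (i : Fin (n - 2)) (oA : ℕ)
    (hoA : oA = 6 * n + 2 + tp (cumT n w) i - bp n (cumT n w) i) :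
    ∃ K, Ker oA (EA n (cumT n w) i) K ∧ K oA oA < 1 := by
  subst hoA
  have hi := i.isLt
  refine nest (bp n (cumT n w)) (fun k => 6 * n + 2 + tp (cumT n w) k) i ?_ ?_
  · intro k hk
    have := steps n w k (by omega)
    omega
  · have := tp_lt n w 0 (by omega)
    omega

lemma exB (n : ℕ) (hn : 3 ≤ n) (w : Fin (n - 2) → Fin 5) (i : Fin (n - 2)) (oB : ℕ)
    (hoB : oB = bp n (cumT n w) (i + 1) - tp (cumT n w) (i + 1)) :
    ∃ K, Ker oB (EB n (cumT n w) i) K ∧ K oB oB < 1 := by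
  subst hoB
  have hi := i.isLt
  have h := nest (fun k => tp (cumT n w) (n - 2 - k)) (fun k => bp n (cumT n w) (n - 2 - k))
    (n - 3 - i) ?_ ?_
  · simp only [show n - 2 - (n - 3 - (i : ℕ)) = i + 1 by omega,
      show n - 3 - (i : ℕ) + 1 = n - 2 - i by omega] at h
    exact h
  · intro k hk
    have := steps n w (n - 2 - (k + 1)) (by omega)
    simp only [show n - 2 - (k + 1) + 1 = n - 2 - k by omega] at this ⊢
    omega
  · have := tp_lt n w (n - 2) (by omega)
    simp only [Nat.sub_zero]
    omega

lemma pathE_rev (o : ℕ) (f g : ℕ → ℝ) :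
    pathE o (fun j => f (o - j)) (fun j => g (o - j)) = pathE o f g := by
  unfold pathE
  rw [← Finset.sum_range_reflect]
  refine Finset.sum_congr rfl fun j hj => ?_
  have := Finset.mem_range.1 hj
  beta_reduce
  rw [show o - (o - 1 - j + 1) = j by omega, show o - (o - 1 - j) = j + 1 by omega]
  ring

end GraphAux

section FinalAux

lemma EA_congr (n : ℕ) (T T' : ℕ → ℕ) (i : ℕ) (h : ∀ k, k ≤ i → T' k = T k) :
    EA n T' i = EA n T i := by
  have ht : ∀ k, k ≤ i → tp T' k = tp T k := by intro k hk; simp only [tp, h k hk]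
  have hb : ∀ k, k ≤ i → bp n T' k = bp n T k := by intro k hk; simp only [bp, h k hk]
  funext f g
  unfold EA pieceE chordE
  rw [ht i le_rfl, hb i le_rfl]
  congr 1
  refine Finset.sum_congr rfl fun k hk => ?_
  have hk := Finset.mem_range.1 hk
  beta_reduce
  rw [ht k (by omega), hb k (by omega)]

lemma EB_rev (n : ℕ) (T T' : ℕ → ℕ) (i oB : ℕ) (hi : i < n - 2)
    (hoB : oB = bp n T (i + 1) - tp T (i + 1))
    (hm : ∀ d, i + 1 + d ≤ n - 2 → T (i + 1) ≤ T (i + 1 + d))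
    (hm' : ∀ d, i + 1 + d ≤ n - 2 → T' (i + 1) ≤ T' (i + 1 + d))
    (h : ∀ d, i + 1 + d ≤ n - 2 →
      T' (i + 1 + d) + T (i + 1 + d) = T' (i + 1) + T (i + 1) + 4 * d) :
    EB n T' i = revE oB (EB n T i) := by
  have ho : oB = bp n T' (i + 1) - tp T' (i + 1) := by
    rw [hoB]; unfold bp tp; omega
  funext f g
  unfold revE EB pieceE
  rw [← ho, ← hoB, pathE_rev]
  congr 1
  unfold chordE
  refine Finset.sum_congr rfl fun k hk => ?_
  have hk := Finset.mem_range.1 hk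
  beta_reduce
  obtain ⟨d, hd⟩ : ∃ d, n - 2 - k = i + 1 + d := ⟨n - 2 - k - (i + 1), by omega⟩
  rw [hd]
  have h1 := hm d (by omega)
  have h2 := hm' d (by omega)
  have h3 := h d (by omega)
  have e1 : oB - (bp n T (i + 1 + d) - tp T (i + 1)) = tp T' (i + 1 + d) - tp T' (i + 1) := by
    rw [hoB]; unfold bp tp; omega
  have e2 : oB - (tp T (i + 1 + d) - tp T (i + 1)) = bp n T' (i + 1 + d) - tp T' (i + 1) := by
    rw [hoB]; unfold bp tp; omega
  rw [e1, e2]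
  ring

end FinalAux

/-- Lemma 7 of the paper. If `w_i = 0` or `w_i = 4` for some `i`, and
`w' = (w_1,…,w_{i-1}, 3, 4-w_{i+1},…,4-w_{n-2})`, then `Kf(O(w)) < Kf(O(w'))`. -/
theorem kirchhoff_lt_of_kink_to_three (n : ℕ) (hn : 3 ≤ n) (w : Fin (n - 2) → Fin 5)
    (i : Fin (n - 2)) (hi : w i = 0 ∨ w i = 4) :
    kirchhoff (octChain n w) <
      kirchhoff (octChain n (fun j => if (j : ℕ) < (i : ℕ) then w j
        else if j = i then (3 : Fin 5) else ⟨4 - (w j : ℕ), by omega⟩)) := by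
  have hil := i.isLt
  generalize hw' : (fun j : Fin (n - 2) => if (j : ℕ) < (i : ℕ) then w j
        else if j = i then (3 : Fin 5) else (⟨4 - (w j : ℕ), by omega⟩ : Fin 5)) = w'
  have v1 : ∀ j : Fin (n - 2), (j : ℕ) < i → (w' j : ℕ) = w j := by
    intro j hj; rw [← hw']; beta_reduce; rw [if_pos hj]
  have v2 : (w' i : ℕ) = 3 := by
    rw [← hw']; beta_reduce; rw [if_neg (lt_irrefl _), if_pos rfl]; rfl
  have v3 : ∀ j : Fin (n - 2), (i : ℕ) < j → (w' j : ℕ) = 4 - (w j : ℕ) := by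
    intro j hj; rw [← hw']; beta_reduce
    rw [if_neg (by omega), if_neg (by intro h; rw [h] at hj; omega)]
  have hT1 : ∀ k, k ≤ (i : ℕ) → cumT n w' k = cumT n w k := by
    intro k
    induction k with
    | zero => intro _; rw [cumT_zero, cumT_zero]
    | succ k ih =>
      intro hk
      rw [cumT_succ n w' k (by omega), cumT_succ n w k (by omega), ih (by omega),
        v1 ⟨k, by omega⟩ (by change k < (i : ℕ); omega)]
  have hT2 : ∀ d, (i : ℕ) + 1 + d ≤ n - 2 → cumT n w' (i + 1 + d) + cumT n w (i + 1 + d)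
      = cumT n w' (i + 1) + cumT n w (i + 1) + 4 * d := by
    intro d
    induction d with
    | zero => intro _; rfl
    | succ d ih =>
      intro hd
      have h1 := ih (by omega)
      have h2 := v3 ⟨(i : ℕ) + 1 + d, by omega⟩ (by change (i : ℕ) < (i : ℕ) + 1 + d; omega)
      have h3 := (w ⟨(i : ℕ) + 1 + d, by omega⟩).isLt
      have h4 := cumT_succ n w' (i + 1 + d) (by omega)
      have h5 := cumT_succ n w (i + 1 + d) (by omega)
      rw [show (i : ℕ) + 1 + (d + 1) = (i : ℕ) + 1 + d + 1 by omega]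
      omega
  obtain ⟨oA, hoA⟩ : ∃ o, o = 6 * n + 2 + tp (cumT n w) i - bp n (cumT n w) i := ⟨_, rfl⟩
  obtain ⟨oB, hoB⟩ : ∃ o, o = bp n (cumT n w) (i + 1) - tp (cumT n w) (i + 1) := ⟨_, rfl⟩
  obtain ⟨KA, hA, hRA⟩ := exA n hn w i oA hoA
  obtain ⟨KB, hB, hRB⟩ := exB n hn w i oB hoB
  have l1 := tp_lt n w i (by omega)
  have l2 := tp_lt n w (i + 1) (by omega)
  have hoA' : oA = 6 * n + 2 + tp (cumT n w') i - bp n (cumT n w') i := by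
    rw [hoA]; unfold tp bp; rw [hT1 i le_rfl]
  have hoB' : oB = bp n (cumT n w') (i + 1) - tp (cumT n w') (i + 1) := by
    rw [hoB]; unfold tp bp; omega
  have hA' : Ker oA (EA n (cumT n w') i) KA := by
    rw [EA_congr n (cumT n w) (cumT n w') i hT1]; exact hA
  have hB' : Ker oB (EB n (cumT n w') i) (revK oB KB) := by
    rw [EB_rev n (cumT n w) (cumT n w') i oB hil hoB (fun d _ => cumT_mono n w (by omega))
      (fun d _ => cumT_mono n w' (by omega)) hT2]
    exact rev_ker hB
  rw [main1 n hn w i KA KB oA oB hoA hoB hA hB,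
    main1 n hn w' i KA (revK oB KB) oA oB hoA' hoB' hA' hB', v2]
  refine kfc_lt hA hB (by omega) (by omega) hRA hRB _ _ ?_
  rcases hi with h | h
  · left; rw [h]; exact ⟨rfl, rfl⟩
  · right; rw [h]; exact ⟨rfl, rfl⟩
end

section
/- Let A be a finite connected simple graph containing distinct vertices u, u_1, u_2, v such that: u has degree 1 with unique neighbor u_1; u_1 has degree 2 with neighbors u and u_2; v is adjacent to u_2; and r_A(v, u_2) < 1 (which holds in particular when the edge vu_2 lies on a cycle of A). Then r_A(u) > r_A(v), i.e., the sum of resistance distances from u to all other vertices of A strictly exceeds the sum of resistance distances from v to all other vertices of A. -/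
lemma mp_exists {n : Type} [Fintype n] (A : Matrix n n ℝ) (hA : A.transpose = A) :
    ∃ M, A.IsMoorePenroseInv M := by
  classical
  have hH : A.IsHermitian := by
    rw [Matrix.IsHermitian, Matrix.conjTranspose_eq_transpose_of_trivial]; exact hA
  obtain ⟨U, d, hU, hAe⟩ : ∃ (U : Matrix n n ℝ) (d : n → ℝ), U.transpose * U = 1 ∧
      A = U * Matrix.diagonal d * U.transpose := by
    refine ⟨(hH.eigenvectorUnitary : Matrix n n ℝ), hH.eigenvalues, ?_, ?_⟩
    · have := Unitary.coe_star_mul_self hH.eigenvectorUnitary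
      rwa [Matrix.star_eq_conjTranspose, Matrix.conjTranspose_eq_transpose_of_trivial] at this
    · have := hH.spectral_theorem
      rw [Unitary.conjStarAlgAut_apply, Matrix.star_eq_conjTranspose,
        Matrix.conjTranspose_eq_transpose_of_trivial] at this
      exact this
  have key : ∀ a b : n → ℝ, (U * Matrix.diagonal a * U.transpose) *
      (U * Matrix.diagonal b * U.transpose) =
      U * Matrix.diagonal (fun i => a i * b i) * U.transpose := by
    intro a b
    calc _ = U * Matrix.diagonal a * (U.transpose * U) * Matrix.diagonal b * U.transpose := by
            simp only [Matrix.mul_assoc]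
      _ = _ := by
            rw [hU, Matrix.mul_one, Matrix.mul_assoc U, Matrix.diagonal_mul_diagonal]
  have ht : ∀ a : n → ℝ, (U * Matrix.diagonal a * U.transpose).transpose =
      U * Matrix.diagonal a * U.transpose := by
    intro a
    rw [Matrix.transpose_mul, Matrix.transpose_mul, Matrix.transpose_transpose,
      Matrix.diagonal_transpose, Matrix.mul_assoc]
  refine ⟨U * Matrix.diagonal (fun i => (d i)⁻¹) * U.transpose, ?_, ?_, ?_, ?_⟩
  · rw [hAe, key, key]
    congr 3
    ext i
    by_cases h : d i = 0 <;> simp [h]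
  · rw [hAe, key, key]
    congr 3
    ext i
    by_cases h : d i = 0 <;> simp [h]
  · rw [hAe, key, ht]
  · rw [hAe, key, ht]

lemma glap_transpose {V : Type} [Fintype V] (G : SimpleGraph V) :
    (glap G).transpose = glap G := by
  ext a b
  simp only [Matrix.transpose_apply, glap]
  by_cases h : a = b
  · subst h; rfl
  · rw [if_neg h, if_neg (Ne.symm h), G.adj_comm]

open Classical in
lemma glap_apply_sum {V : Type} [Fintype V] (G : SimpleGraph V) (f : V → ℝ) (z : V) :
    ∑ t, glap G z t * f t = ∑ t, if G.Adj z t then f z - f t else 0 := by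
  have h1 : ∀ t, glap G z t * f t =
      (if z = t then ((Finset.univ.filter (fun t => G.Adj z t)).card : ℝ) * f z else 0)
        + (if G.Adj z t then - f t else 0) := by
    intro t
    unfold glap
    by_cases h : z = t
    · subst h; simp
    · by_cases h2 : G.Adj z t <;> simp [h, h2]
  rw [Finset.sum_congr rfl (fun t _ => h1 t), Finset.sum_add_distrib,
    Finset.sum_ite_eq]
  simp only [Finset.mem_univ, if_true]
  rw [Finset.card_filter]
  push_cast
  rw [Finset.sum_mul, ← Finset.sum_add_distrib]
  refine Finset.sum_congr rfl (fun t _ => ?_)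
  split_ifs <;> ring

lemma max_principle {V : Type} [Fintype V] (G : SimpleGraph V) (hG : G.Connected)
    (f : V → ℝ) (y : V) (h : ∀ z, z ≠ y → ∑ t, glap G z t * f t ≤ 0) (x : V) : f x ≤ f y := by
  classical
  obtain ⟨m, -, hm⟩ := Finset.exists_max_image Finset.univ f ⟨x, Finset.mem_univ x⟩
  have hm' : ∀ t, f t ≤ f m := fun t => hm t (Finset.mem_univ t)
  by_contra hlt
  have hy : f y ≠ f m := by
    intro h'; exact hlt (h' ▸ hm' x)
  have step : ∀ a b, f a = f m → G.Adj a b → f b = f m := by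
    intro a b ha hab
    have hay : a ≠ y := by rintro rfl; exact hy ha
    have h1 := h a hay
    rw [glap_apply_sum] at h1
    have hnn : ∀ t ∈ Finset.univ, 0 ≤ (if G.Adj a t then f a - f t else 0) := by
      intro t _
      split_ifs
      · have := hm' t; linarith
      · exact le_rfl
    have h2 := Finset.single_le_sum hnn (Finset.mem_univ b)
    rw [if_pos hab] at h2
    have := hm' b
    linarith
  have all : ∀ a b (w : G.Walk a b), f a = f m → f b = f m := by
    intro a b w
    induction w with
    | nil => exact id
    | cons hab _ ih => exact fun ha => ih (step _ _ ha hab)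
  obtain ⟨w⟩ := hG.preconnected m y
  exact hy (all _ _ w rfl)

lemma glap_row_sum {V : Type} [Fintype V] (G : SimpleGraph V) (z : V) :
    ∑ t, glap G z t = 0 := by
  have := glap_apply_sum G (fun _ => 1) z
  simpa using this

lemma mpinv_props {V : Type} [Fintype V] [DecidableEq V] (G : SimpleGraph V)
    (hG : G.Connected) :
    (∀ a b, mpinv (glap G) a b = mpinv (glap G) b a) ∧
    (∀ a, ∑ b, mpinv (glap G) a b = 0) ∧
    (∀ a b, ∑ t, glap G a t * mpinv (glap G) t b =
      (if a = b then 1 else 0) - 1 / (Fintype.card V : ℝ)) := by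
  have hex := mp_exists (glap G) (glap_transpose G)
  have hM : (glap G).IsMoorePenroseInv (mpinv (glap G)) := by
    rw [mpinv, dif_pos hex]; exact hex.choose_spec
  have hLt := glap_transpose G
  have hrow := glap_row_sum G
  generalize mpinv (glap G) = M at *
  obtain ⟨h1, h2, h3, h4⟩ := hM
  have hcol : ∀ t, ∑ z, glap G z t = 0 := by
    intro t
    rw [← hrow t]
    refine Finset.sum_congr rfl (fun z _ => ?_)
    conv_lhs => rw [← hLt]
    rfl
  haveI := hG.nonempty
  set L := glap G with hL
  have hn : (Fintype.card V : ℝ) ≠ 0 := by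
    have : Fintype.card V ≠ 0 := Fintype.card_ne_zero
    exact_mod_cast this
  -- N = 1 - L M
  have hLN : L * (1 - L * M) = 0 := by
    have : ((1 - L * M) * L).transpose = 0 := by
      rw [Matrix.sub_mul, Matrix.one_mul, h1, sub_self, Matrix.transpose_zero]
    rwa [Matrix.transpose_mul, Matrix.transpose_sub, h3, hLt, Matrix.transpose_one] at this
  have hconst : ∀ b x y, (1 - L * M) x b = (1 - L * M) y b := by
    intro b
    have hz : ∀ z, ∑ t, L z t * (1 - L * M) t b = 0 := by
      intro z
      have := congrFun (congrFun hLN z) b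
      rwa [Matrix.mul_apply] at this
    have hle : ∀ x y, (1 - L * M) x b ≤ (1 - L * M) y b := fun x y =>
      max_principle G hG (fun t => (1 - L * M) t b) y (fun z _ => (hz z).le) x
    exact fun x y => le_antisymm (hle x y) (hle y x)
  have hcolsum : ∀ b, ∑ a, (L * M) a b = 0 := by
    intro b
    simp only [Matrix.mul_apply]
    rw [Finset.sum_comm]
    refine Finset.sum_eq_zero (fun t _ => ?_)
    rw [← Finset.sum_mul, hcol, zero_mul]
  have hNval : ∀ a b, (1 - L * M) a b = 1 / (Fintype.card V : ℝ) := by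
    intro a b
    have hs : ∑ x, (1 - L * M) x b = 1 := by
      simp only [Matrix.sub_apply, Finset.sum_sub_distrib, hcolsum, Matrix.one_apply]
      simp
    rw [Finset.sum_congr rfl (fun x _ => hconst b x a)] at hs
    simp only [Finset.sum_const, Finset.card_univ, nsmul_eq_mul] at hs
    field_simp
    linarith
  have hLM : ∀ a b, (L * M) a b = (if a = b then 1 else 0) - 1 / (Fintype.card V : ℝ) := by
    intro a b
    have := hNval a b
    rw [Matrix.sub_apply, Matrix.one_apply] at this
    linarith
  -- columns of M sum to zero
  have hMc : ∀ b, ∑ a, M a b = 0 := by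
    intro b
    have e : M = L * (M.transpose * M) := by
      have : M * L * M = (M * L).transpose * M := by rw [h4]
      rw [h2, Matrix.transpose_mul, hLt, Matrix.mul_assoc] at this
      exact this
    have e' : ∀ a, M a b = ∑ t, L a t * (M.transpose * M) t b := by
      intro a
      conv_lhs => rw [e]
      rw [Matrix.mul_apply]
    rw [Finset.sum_congr rfl (fun a _ => e' a), Finset.sum_comm]
    refine Finset.sum_eq_zero (fun t _ => ?_)
    rw [← Finset.sum_mul, hcol, zero_mul]
  have hPM : (L * M) * M = M := by
    ext a b
    rw [Matrix.mul_apply]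
    simp only [hLM, sub_mul, Finset.sum_sub_distrib, ← Finset.mul_sum, hMc]
    simp
  have hsym : M.transpose = M := by
    have e : M = M.transpose * L * M := by
      conv_lhs => rw [← hPM, ← h3, Matrix.transpose_mul, hLt]
    rw [e]
    simp only [Matrix.transpose_mul, Matrix.transpose_transpose, hLt, Matrix.mul_assoc]
  have hs : ∀ a b, M a b = M b a := by
    intro a b
    conv_lhs => rw [← hsym]
    rfl
  refine ⟨hs, fun a => ?_, fun a b => ?_⟩
  · rw [← hMc a]; exact Finset.sum_congr rfl (fun t _ => hs a t)
  · rw [← hLM a b, Matrix.mul_apply]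

lemma resSum_eq {V : Type} [Fintype V] [DecidableEq V] (G : SimpleGraph V)
    (hG : G.Connected) (a : V) :
    resSum G a = (Fintype.card V : ℝ) * mpinv (glap G) a a + ∑ b, mpinv (glap G) b b := by
  obtain ⟨hs, h0, -⟩ := mpinv_props G hG
  have h : resSum G a = ∑ b, resDist G a b := by
    rw [resSum, ← Finset.add_sum_erase Finset.univ (resDist G a) (Finset.mem_univ a)]
    simp [resDist]
  rw [h]
  simp only [resDist]
  have h0' : ∑ b, mpinv (glap G) b a = 0 := by
    rw [← h0 a]; exact Finset.sum_congr rfl (fun t _ => hs t a)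
  rw [Finset.sum_add_distrib, Finset.sum_sub_distrib, Finset.sum_sub_distrib, h0, h0']
  simp

/-- In a connected graph `A`, if `u` is a pendant vertex whose unique
neighbour `u₁` has degree 2 with other neighbour `u₂`, and `v` is adjacent to `u₂` with
`r_A(v, u₂) < 1`, then `r_A(u) > r_A(v)`. -/
theorem resSum_pendant_gt {V : Type} [Fintype V] [DecidableEq V] (A : SimpleGraph V)
    (hA : A.Connected) (u u₁ u₂ v : V) (hd : [u, u₁, u₂, v].Pairwise (· ≠ ·))
    (hu : ∀ t, A.Adj u t ↔ t = u₁)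
    (hu₁ : ∀ t, A.Adj u₁ t ↔ (t = u ∨ t = u₂))
    (hv : A.Adj v u₂)
    (hres : resDist A v u₂ < 1) :
    resSum A u > resSum A v := by
  classical
  obtain ⟨hs, h0, hL⟩ := mpinv_props A hA
  rw [gt_iff_lt, resSum_eq A hA, resSum_eq A hA]
  simp only [List.pairwise_cons, List.mem_cons, List.not_mem_nil, or_false, forall_eq_or_imp,
    forall_eq] at hd
  obtain ⟨⟨huu1, huu2, huv⟩, ⟨hu12, hu1v⟩, hu2v, -⟩ := hd
  have hcard : 4 ≤ Fintype.card V := by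
    have : ({u, u₁, u₂, v} : Finset V).card = 4 := by
      rw [Finset.card_insert_of_notMem, Finset.card_insert_of_notMem, Finset.card_insert_of_notMem,
        Finset.card_singleton] <;> simp [*]
    rw [← this]; exact Finset.card_le_univ _
  have hn4 : (4 : ℝ) ≤ Fintype.card V := by exact_mod_cast hcard
  have hL' := fun a b => (glap_apply_sum A (fun t => mpinv (glap A) t b) a).symm.trans (hL a b)
  unfold resDist at hres
  generalize hMdef : mpinv (glap A) = M at *
  generalize hc : (Fintype.card V : ℝ) = n at *
  have hru : ∀ b, M u b - M u₁ b = (if u = b then 1 else 0) - 1 / n := by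
    intro b
    rw [← hL' u b]
    simp [hu]
  have hru1 : ∀ b, (M u₁ b - M u b) + (M u₁ b - M u₂ b) = (if u₁ = b then 1 else 0) - 1 / n := by
    intro b
    rw [← hL' u₁ b]
    have : ∀ t, (if A.Adj u₁ t then M u₁ b - M t b else 0) =
        (if t = u then M u₁ b - M t b else 0) + (if t = u₂ then M u₁ b - M t b else 0) := by
      intro t
      by_cases h1 : t = u
      · subst h1; simp [hu₁, huu2]
      · simp [hu₁, h1]
    rw [Finset.sum_congr rfl (fun t _ => this t), Finset.sum_add_distrib]
    simp
  have hmax : ∀ x, M x u₂ - M x v ≤ M u₂ u₂ - M u₂ v := by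
    intro x
    refine max_principle A hA (fun t => M t u₂ - M t v) u₂ (fun z hz => ?_) x
    simp only [mul_sub, Finset.sum_sub_distrib, hL]
    rw [if_neg hz]
    split_ifs <;> norm_num
  have hsum : M v v - M u₂ v ≤ (n - 1) * (M u₂ u₂ - M u₂ v) := by
    have h1 : ∑ x ∈ Finset.univ.erase v, (M x u₂ - M x v) ≤
        ∑ x ∈ Finset.univ.erase v, (M u₂ u₂ - M u₂ v) := Finset.sum_le_sum (fun x _ => hmax x)
    have h2 := Finset.add_sum_erase Finset.univ (fun x => M x u₂ - M x v) (Finset.mem_univ v)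
    have h3 : ∑ x, (M x u₂ - M x v) = 0 := by
      rw [Finset.sum_sub_distrib, Finset.sum_congr rfl (fun x _ => hs x u₂),
        Finset.sum_congr rfl (fun x _ => hs x v), h0, h0, sub_zero]
    rw [Finset.sum_const, Finset.card_erase_of_mem (Finset.mem_univ v), Finset.card_univ,
      nsmul_eq_mul, Nat.cast_sub (by omega), hc] at h1
    rw [h3] at h2
    simp only [Nat.cast_one] at h1
    have := hs v u₂
    linarith
  have a1 := hru u
  have a2 := hru u₂
  have b1 := hru1 u
  have b2 := hru1 u₂
  rw [if_pos rfl] at a1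
  rw [if_neg huu2] at a2
  rw [if_neg (Ne.symm huu1)] at b1
  rw [if_neg hu12] at b2
  have hval : M u u - M u₂ u₂ = 2 - 6 * (1 / n) := by
    have := hs u u₂
    linarith
  have hn0 : (0 : ℝ) < n := by linarith
  have hval' : n * M u u - n * M u₂ u₂ = 2 * n - 6 := by
    have : n * (M u u - M u₂ u₂) = 2 * n - 6 := by rw [hval]; field_simp
    linarith
  have e := hs v u₂
  rw [e] at hres
  have hlt : n * (M v v - M u₂ u₂) < 2 * n - 6 := by
    nlinarith
  linarith
end
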